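/- arXiv:2301.03186 — 2 statements merged into one kernel-verified Lean document; each statement's English description precedes it below -/
import Mathlib

section
/- Fix a real L < 0 and reals y_0, y_1 with y_0 < y_1 < log(1 − 1/L), and fix any y with y_0 < y < log(1 − 1/L). Let Y_1, …, Y_n be reals with y_0 ≤ Y_i ≤ y_1 for all i. Then Σ_{i=1}^n log(1 + L·(e^{Y_i} − 1)) ≤ n·(a_0·m_2 + b_0·m_1 + c_0), where a_0, b_0, c_0 are the quadratic coefficients determined by L, y and y_0. (This is the upper bound of Theorem 4.) -/
open Set in
/-- If `h'` is concave on `[a, b]` and `h` vanishes at `a` and to second order at `y`,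
then `h ≤ 0` on `[a, b]`. -/
theorem nonpos_of_concaveOn_deriv {h h' : ℝ → ℝ} {a b y : ℝ} (hay : a < y) (hyb : y ≤ b)
    (hd : ∀ x ∈ Icc a b, HasDerivAt h (h' x) x) (hc : ConcaveOn ℝ (Icc a b) h')
    (ha : h a = 0) (hy : h y = 0) (hy' : h' y = 0) {x : ℝ} (hx : x ∈ Icc a b) : h x ≤ 0 := by
  have hcont : ContinuousOn h (Icc a b) := fun t ht => (hd t ht).continuousAt.continuousWithinAt
  obtain ⟨z, ⟨haz, hzy⟩, hz⟩ : ∃ z ∈ Ioo a y, h' z = 0 :=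
    exists_hasDerivAt_eq_zero hay (hcont.mono (Icc_subset_Icc_right hyb)) (ha.trans hy.symm)
      fun t ht => hd t ⟨ht.1.le, ht.2.le.trans hyb⟩
  have hzm : z ∈ Icc a b := ⟨haz.le, hzy.le.trans hyb⟩
  have hym : y ∈ Icc a b := ⟨hay.le, hyb⟩
  have hleft : AntitoneOn h (Icc a z) := by
    refine antitoneOn_of_hasDerivWithinAt_nonpos (f' := h') (convex_Icc a z)
      (hcont.mono (Icc_subset_Icc_right hzm.2)) ?_ ?_ <;> intro t ht <;>
      rw [interior_Icc] at ht
    · exact (hd t ⟨ht.1.le, ht.2.le.trans hzm.2⟩).hasDerivWithinAt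
    · have := hc.slope_anti_adjacent ⟨ht.1.le, ht.2.le.trans hzm.2⟩ hym ht.2 hzy
      rw [hz, hy', sub_zero, zero_div, le_div_iff₀ (sub_pos.2 ht.2)] at this
      linarith
  have hmid : MonotoneOn h (Icc z y) := by
    refine monotoneOn_of_hasDerivWithinAt_nonneg (f' := h') (convex_Icc z y)
      (hcont.mono (Icc_subset_Icc haz.le hyb)) ?_ ?_ <;> intro t ht <;>
      rw [interior_Icc] at ht
    · exact (hd t ⟨haz.le.trans ht.1.le, ht.2.le.trans hyb⟩).hasDerivWithinAt
    · have := hc.min_le_of_mem_Icc hzm hym ⟨ht.1.le, ht.2.le⟩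
      rwa [hz, hy', min_self] at this
  have hright : AntitoneOn h (Icc y b) := by
    refine antitoneOn_of_hasDerivWithinAt_nonpos (f' := h') (convex_Icc y b)
      (hcont.mono (Icc_subset_Icc_left hay.le)) ?_ ?_ <;> intro t ht <;>
      rw [interior_Icc] at ht
    · exact (hd t ⟨hay.le.trans ht.1.le, ht.2.le⟩).hasDerivWithinAt
    · have := hc.slope_anti_adjacent hzm ⟨hay.le.trans ht.1.le, ht.2.le⟩ hzy ht.1
      rw [hz, hy', sub_self, zero_div, div_le_iff₀ (sub_pos.2 ht.1)] at this
      linarith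
  rcases le_total x z with hxz | hzx
  · exact (hleft ⟨le_rfl, haz.le⟩ ⟨hx.1, hxz⟩ hx.1).trans_eq ha
  rcases le_total x y with hxy | hyx
  · exact (hmid ⟨hzx, hxy⟩ ⟨hzy.le, le_rfl⟩ hxy).trans_eq hy
  · exact (hright ⟨le_rfl, hyb⟩ ⟨hyx, hx.2⟩ hyx).trans_eq hy

/-- A daily log-return below `log (1 - 1 / L)` keeps the inversely leveraged index positive. -/
theorem leveraged_return_pos {L x : ℝ} (hL : L < 0) (hx : x < Real.log (1 - 1 / L)) :
    0 < 1 + L * (Real.exp x - 1) := by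
  have hpos : 0 < 1 - 1 / L := by linarith [one_div_neg.2 hL]
  have hlt := mul_lt_mul_of_neg_left ((Real.lt_log_iff_exp_lt hpos).1 hx) hL
  have : L * (1 - 1 / L) = L - 1 := by field_simp [hL.ne]
  linarith

theorem hasDerivAt_log_leveraged_return {L x : ℝ} (hx : 0 < 1 + L * (Real.exp x - 1)) :
    HasDerivAt (fun t => Real.log (1 + L * (Real.exp t - 1)))
      (L * Real.exp x / (1 + L * (Real.exp x - 1))) x :=
  ((((Real.hasDerivAt_exp x).sub_const 1).const_mul L).const_add 1).log hx.ne'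

theorem concaveOn_deriv_log_leveraged_return {L : ℝ} (hL : L < 0) {s : Set ℝ} (hs : Convex ℝ s)
    (hpos : ∀ x ∈ s, 0 < 1 + L * (Real.exp x - 1)) :
    ConcaveOn ℝ s fun x => L * Real.exp x / (1 + L * (Real.exp x - 1)) := by
  refine ⟨hs, fun u hu v hv p q hp hq hpq => ?_⟩
  have hw := hpos _ (hs hu hv hp hq hpq)
  have hE := convexOn_exp.2 (Set.mem_univ u) (Set.mem_univ v) hp hq hpq
  have hU := hpos u hu
  have hV := hpos v hv
  simp only [smul_eq_mul] at hw hE ⊢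
  have hrw : ∀ t : ℝ, 0 < 1 + L * (t - 1) →
      L * t / (1 + L * (t - 1)) = 1 - (1 - L) * (1 + L * (t - 1))⁻¹ := by
    intro t ht
    field_simp
    ring
  rw [hrw _ hU, hrw _ hV, hrw _ hw]
  have hinv := (convexOn_zpow (𝕜 := ℝ) (-1)).2 (Set.mem_Ioi.2 hU) (Set.mem_Ioi.2 hV) hp hq hpq
  simp only [smul_eq_mul, zpow_neg_one] at hinv
  have hle : p * (1 + L * (Real.exp u - 1)) + q * (1 + L * (Real.exp v - 1)) ≤
      1 + L * (Real.exp (p * u + q * v) - 1) := by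
    have := mul_le_mul_of_nonpos_left hE hL.le
    linear_combination this + (1 - L) * hpq
  have hmean : 0 < p * (1 + L * (Real.exp u - 1)) + q * (1 + L * (Real.exp v - 1)) :=
    convex_Ioi (0 : ℝ) hU hV hp hq hpq
  have := mul_le_mul_of_nonneg_left ((inv_anti₀ hmean hle).trans hinv) (by linarith : 0 ≤ 1 - L)
  linear_combination this + hpq


theorem stmt_7 (L y0 y1 y : ℝ) (hL : L < 0)
    (h01 : y0 < y1) (h1 : y1 < Real.log (1 - 1 / L)) (hy0 : y0 < y) (hy1 : y < Real.log (1 - 1 / L))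
    (n : ℕ) (Y : Fin n → ℝ) (hY : ∀ i, y0 ≤ Y i ∧ Y i ≤ y1)
    (a b c m1 m2 : ℝ)
    (ha : a = (1 / (y - y0)) *
      (Real.log ((1 + L * (Real.exp y0 - 1)) / (1 + L * (Real.exp y - 1))) / (y - y0)
        + L * Real.exp y / (1 + L * (Real.exp y - 1))))
    (hb : b = L * Real.exp y / (1 + L * (Real.exp y - 1)) - 2 * a * y)
    (hc : c = Real.log (1 + L * (Real.exp y0 - 1)) - a * y0 ^ 2 - b * y0)
    (hm1 : m1 = (1 / (n : ℝ)) * ∑ i, Y i)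
    (hm2 : m2 = (1 / (n : ℝ)) * ∑ i, (Y i) ^ 2) :
    ∑ i, Real.log (1 + L * (Real.exp (Y i) - 1)) ≤ (n : ℝ) * (a * m2 + b * m1 + c) := by
  have hpos : ∀ x ∈ Set.Icc y0 (max y1 y), 0 < 1 + L * (Real.exp x - 1) := fun x hx =>
    leveraged_return_pos hL (hx.2.trans_lt (max_lt h1 hy1))
  have hym : y ∈ Set.Icc y0 (max y1 y) := ⟨hy0.le, le_max_right _ _⟩
  have hg0 := hpos y0 ⟨le_rfl, hy0.le.trans hym.2⟩
  have hgy := hpos y hym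
  have hne : y - y0 ≠ 0 := (sub_pos.2 hy0).ne'
  have key : ∀ x ∈ Set.Icc y0 (max y1 y),
      Real.log (1 + L * (Real.exp x - 1)) - (a * x ^ 2 + b * x + c) ≤ 0 := by
    intro x hx
    refine nonpos_of_concaveOn_deriv
      (h := fun t => Real.log (1 + L * (Real.exp t - 1)) - (a * t ^ 2 + b * t + c))
      (h' := fun t => L * Real.exp t / (1 + L * (Real.exp t - 1)) - (2 * a * t + b))
      hy0 hym.2 (fun t ht => ?_) ?_ ?_ ?_ ?_ hx
    · have hq : HasDerivAt (fun t : ℝ => a * t ^ 2 + b * t + c) (2 * a * t + b) t := by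
        refine ((((hasDerivAt_pow 2 t).const_mul a).add
          ((hasDerivAt_id t).const_mul b)).add_const c).congr_deriv ?_
        norm_num
        ring
      exact (hasDerivAt_log_leveraged_return (hpos t ht)).sub hq
    · refine (concaveOn_deriv_log_leveraged_return hL (convex_Icc _ _) hpos).sub
        ⟨convex_Icc _ _, fun u _ v _ p q _ _ hpq => ?_⟩
      simp only [smul_eq_mul]
      linear_combination (-b) * hpq
    · simp only [hc]
      ring
    · have hmul : a * (y - y0) ^ 2 =
          Real.log (1 + L * (Real.exp y0 - 1)) - Real.log (1 + L * (Real.exp y - 1))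
            + L * Real.exp y / (1 + L * (Real.exp y - 1)) * (y - y0) := by
        rw [ha, ← Real.log_div hg0.ne' hgy.ne']
        generalize L * Real.exp y / (1 + L * (Real.exp y - 1)) = d
        field_simp
      simp only [hc]
      linear_combination (y0 - y) * hb + hmul
    · simp only [hb]
      ring
  have hn : (n : ℝ) * (a * m2 + b * m1 + c) = ∑ i, (a * Y i ^ 2 + b * Y i + c) := by
    rw [hm1, hm2, Finset.sum_add_distrib, Finset.sum_add_distrib, ← Finset.mul_sum,
      ← Finset.mul_sum, Finset.sum_const, Finset.card_fin, nsmul_eq_mul]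
    rcases eq_or_ne n 0 with rfl | h
    · simp
    · field_simp
  rw [hn]
  exact Finset.sum_le_sum fun i _ =>
    sub_nonpos.1 (key _ ⟨(hY i).1, (hY i).2.trans (le_max_left _ _)⟩)
end

section
/- Fix a real L > 1 and reals y_0, y with log(1 − 1/L) < y_0 < y. Let p(x) = a_0·x² + b_0·x + c_0 with a_0, b_0, c_0 the quadratic coefficients determined by L, y and y_0, and let f(x) = log(1 + L·(e^x − 1)). Then p(x) ≤ f(x) for every x ≥ y_0. (Pointwise quadratic lower bound used in the proof of Theorem 1; p agrees with f at y_0 and at y and has the same derivative as f at y.) -/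
/-- A function vanishing at `u` and to second order at `v > u`, with convex derivative, is
nonnegative to the right of `u`. -/
theorem nonneg_of_convexOn_deriv {g g' : ℝ → ℝ} {u v : ℝ} (huv : u < v)
    (hg : ∀ x ∈ Set.Ici u, HasDerivAt g (g' x) x) (hconv : ConvexOn ℝ (Set.Ici u) g')
    (hu : g u = 0) (hv : g v = 0) (hv' : g' v = 0) {x : ℝ} (hx : u ≤ x) : 0 ≤ g x := by
  have hcont : ContinuousOn g (Set.Ici u) := fun t ht => (hg t ht).continuousAt.continuousWithinAt
  obtain ⟨ξ, hξ, hξ'⟩ := exists_hasDerivAt_eq_zero huv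
    (hcont.mono Set.Icc_subset_Ici_self) (hu.trans hv.symm)
    (fun t ht => hg t ht.1.le)
  rcases le_total x ξ with h1 | h1
  · have hmono : MonotoneOn g (Set.Icc u ξ) := by
      refine monotoneOn_of_hasDerivWithinAt_nonneg (f' := g') (convex_Icc u ξ)
        (hcont.mono Set.Icc_subset_Ici_self) ?_ ?_
      · intro t ht
        rw [interior_Icc] at ht
        exact (hg t ht.1.le).hasDerivWithinAt
      · intro t ht
        rw [interior_Icc] at ht
        have h := hconv.slope_mono_adjacent (x := t) (y := ξ) (z := v)
          ht.1.le huv.le ht.2 hξ.2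
        rw [hξ', hv', sub_zero, zero_div, div_le_iff₀ (sub_pos.2 ht.2)] at h
        linarith
    rw [← hu]
    exact hmono ⟨le_rfl, hξ.1.le⟩ ⟨hx, h1⟩ hx
  rcases le_total x v with h2 | h2
  · have hanti : AntitoneOn g (Set.Icc ξ v) := by
      refine antitoneOn_of_hasDerivWithinAt_nonpos (f' := g') (convex_Icc ξ v)
        (hcont.mono fun t ht => hξ.1.le.trans ht.1) ?_ ?_
      · intro t ht
        rw [interior_Icc] at ht
        exact (hg t (hξ.1.trans ht.1).le).hasDerivWithinAt
      · intro t ht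
        rw [interior_Icc] at ht
        have h := hconv.le_max_of_mem_Icc (x := ξ) (y := v) (z := t)
          hξ.1.le huv.le ⟨ht.1.le, ht.2.le⟩
        simpa [hξ', hv'] using h
    rw [← hv]
    exact hanti ⟨h1, h2⟩ ⟨hξ.2.le, le_rfl⟩ h2
  · have hmono : MonotoneOn g (Set.Ici v) := by
      refine monotoneOn_of_hasDerivWithinAt_nonneg (f' := g') (convex_Ici v)
        (hcont.mono (Set.Ici_subset_Ici.2 huv.le)) ?_ ?_
      · intro t ht
        rw [interior_Ici] at ht
        exact (hg t (huv.trans ht).le).hasDerivWithinAt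
      · intro t ht
        rw [interior_Ici] at ht
        have h := hconv.slope_mono_adjacent (x := ξ) (y := v) (z := t)
          hξ.1.le (huv.trans ht).le hξ.2 ht
        rw [hξ', hv', sub_zero, zero_div, le_div_iff₀ (sub_pos.2 ht)] at h
        linarith
    rw [← hv]
    exact hmono Set.self_mem_Ici h2 h2

/-- The reciprocal of a positive concave function is convex. -/
theorem ConcaveOn.convexOn_inv_of_pos {s : Set ℝ} {f : ℝ → ℝ} (hf : ConcaveOn ℝ s f)
    (hpos : ∀ x ∈ s, 0 < f x) : ConvexOn ℝ s fun x => (f x)⁻¹ := by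
  refine ⟨hf.1, fun x hx z hz α β hα hβ hαβ => ?_⟩
  have hinv := (convexOn_zpow (𝕜 := ℝ) (-1)).2 (hpos x hx) (hpos z hz) hα hβ hαβ
  have hcomb : 0 < α • f x + β • f z := convex_Ioi (0 : ℝ) (hpos x hx) (hpos z hz) hα hβ hαβ
  simp only [zpow_neg_one] at hinv
  exact (inv_anti₀ hcomb (hf.2 hx hz hα hβ hαβ)).trans hinv

theorem one_add_mul_exp_sub_one_pos {L x : ℝ} (hL : 1 < L) (hx : Real.log (1 - 1 / L) < x) :
    0 < 1 + L * (Real.exp x - 1) := by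
  have hL0 : 0 < L := by linarith
  have h1 : 0 < 1 - 1 / L := by
    rw [sub_pos, div_lt_one hL0]
    exact hL
  have h2 := mul_lt_mul_of_pos_left ((Real.log_lt_iff_lt_exp h1).1 hx) hL0
  have h3 : L * (1 - 1 / L) = L - 1 := by field_simp
  linarith

theorem convexOn_mul_exp_div {L u : ℝ} (hL : 1 < L) (hu : Real.log (1 - 1 / L) < u) :
    ConvexOn ℝ (Set.Ici u) fun x => L * Real.exp x / (1 + L * (Real.exp x - 1)) := by
  have hfactor (x : ℝ) :
      1 + L * (Real.exp x - 1) = Real.exp x * (L - (L - 1) * Real.exp (-x)) := by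
    rw [Real.exp_neg]
    field_simp
    ring
  have hexp : ConvexOn ℝ (Set.Ici u) fun x : ℝ => Real.exp (-x) :=
    ⟨convex_Ici u, fun x _ z _ α β hα hβ hαβ => by
      have h := convexOn_exp.2 (Set.mem_univ (-x)) (Set.mem_univ (-z)) hα hβ hαβ
      convert h using 2
      simp only [smul_eq_mul]
      ring⟩
  have hconc : ConcaveOn ℝ (Set.Ici u) fun x => L - (L - 1) * Real.exp (-x) :=
    (concaveOn_const L (convex_Ici u)).sub (hexp.smul (sub_pos.2 hL).le)
  have hpos : ∀ x ∈ Set.Ici u, 0 < L - (L - 1) * Real.exp (-x) := fun x hx => by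
    have h := one_add_mul_exp_sub_one_pos hL (hu.trans_le hx)
    rw [hfactor] at h
    exact pos_of_mul_pos_right h (Real.exp_pos x).le
  refine ((hconc.convexOn_inv_of_pos hpos).smul (zero_lt_one.trans hL).le).congr fun x hx => ?_
  have hne := (hpos x hx).ne'
  simp only [smul_eq_mul, hfactor]
  field_simp

theorem stmt_8 (L y0 y : ℝ) (hL : 1 < L)
    (h0 : Real.log (1 - 1 / L) < y0) (h0y : y0 < y)
    (a b c : ℝ)
    (ha : a = (1 / (y - y0)) *
      (Real.log ((1 + L * (Real.exp y0 - 1)) / (1 + L * (Real.exp y - 1))) / (y - y0)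
        + L * Real.exp y / (1 + L * (Real.exp y - 1))))
    (hb : b = L * Real.exp y / (1 + L * (Real.exp y - 1)) - 2 * a * y)
    (hc : c = Real.log (1 + L * (Real.exp y0 - 1)) - a * y0 ^ 2 - b * y0) :
    ∀ x : ℝ, y0 ≤ x → a * x ^ 2 + b * x + c ≤ Real.log (1 + L * (Real.exp x - 1)) := by
  intro x hx
  have hpos (t : ℝ) (ht : y0 ≤ t) := one_add_mul_exp_sub_one_pos hL (h0.trans_le ht)
  have hlin : ConcaveOn ℝ (Set.Ici y0) fun t : ℝ => 2 * a * t + b :=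
    ⟨convex_Ici y0, fun s _ t _ α β _ _ hαβ => by
      simp only [smul_eq_mul]
      linear_combination b * hαβ⟩
  rw [← sub_nonneg]
  refine nonneg_of_convexOn_deriv
    (g := fun t => Real.log (1 + L * (Real.exp t - 1)) - (a * t ^ 2 + b * t + c))
    h0y (fun t ht => ?_) ((convexOn_mul_exp_div hL h0).sub hlin) ?_ ?_ ?_ hx
  · have hlog := ((((Real.hasDerivAt_exp t).sub_const 1).const_mul L).const_add 1).log
      (hpos t ht).ne'
    have hquad := ((((hasDerivAt_id t).pow 2).const_mul a).add
      ((hasDerivAt_id t).const_mul b)).add_const c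
    refine (hlog.sub hquad).congr_deriv ?_
    simp only [Pi.sub_apply, id_eq]
    push_cast
    ring
  · simp only [hc]
    ring
  · have hne : y - y0 ≠ 0 := (sub_pos.2 h0y).ne'
    rw [Real.log_div (hpos y0 le_rfl).ne' (hpos y h0y.le).ne'] at ha
    generalize L * Real.exp y / (1 + L * (Real.exp y - 1)) = d at ha hb
    have ha' : a * (y - y0) ^ 2 = Real.log (1 + L * (Real.exp y0 - 1))
        - Real.log (1 + L * (Real.exp y - 1)) + d * (y - y0) := by
      rw [ha]
      field_simp
    simp only [hc, hb]
    linear_combination ha'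
  · simp only [Pi.sub_apply, hb]
    ring
end
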